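/- Lemma 4.2: let F be a distribution function with F(1) = 0 lying in Γ, and G(x) = F(e^x) with upper endpoint y₀ = sup{x : G(x) < 1}. Then for every integer p ≥ 1: (i) (z − x)^p / R_p(z, G) → +∞, and (ii) R_p(x, z, G)/R_p(x, G) → 1, in the joint limit where x → y₀, z → y₀, x < z, and (1 − G(z))/(1 − G(x)) → 0. -/

import Mathlib

open MeasureTheory Filter Topology Set

noncomputable section

/-- A distribution function: nondecreasing, right-continuous, with limits 0 at -∞ and 1 at +∞. -/
def IsDF (F : ℝ → ℝ) : Prop :=
  Monotone F ∧ (∀ x, ContinuousWithinAt F (Set.Ici x) x) ∧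
    Tendsto F atBot (𝓝 0) ∧ Tendsto F atTop (𝓝 1)

/-- `F` lies in the domain of attraction of `M`. -/
def MemDomAttr (F M : ℝ → ℝ) : Prop :=
  ∃ a b : ℕ → ℝ, (∀ n, 0 < a n) ∧
    ∀ x, ContinuousAt M x →
      Tendsto (fun n => F (a n * x + b n) ^ n) atTop (𝓝 (M x))

/-- The Gumbel distribution function Λ. -/
def gumbelDF (x : ℝ) : ℝ := Real.exp (-Real.exp (-x))

/-- The Fréchet distribution function φ_γ. -/
def frechetDF (γ : ℝ) (x : ℝ) : ℝ := if 0 < x then Real.exp (-(x ^ (-γ))) else 0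

/-- The Weibull distribution function ψ_γ. -/
def weibullDF (γ : ℝ) (x : ℝ) : ℝ := if x < 0 then Real.exp (-((-x) ^ γ)) else 1

/-- Generalized inverse `F⁻¹(u) = inf {x | F x ≥ u}`. -/
def genInv (F : ℝ → ℝ) (u : ℝ) : ℝ := sInf {x | u ≤ F x}

/-- Upper endpoint `x₀(F) = sup {x | F x < 1}`. -/
def upEnd (F : ℝ → ℝ) : ℝ := sSup {x | F x < 1}

/-- Membership in `D(φ) = ⋃_{γ>0} D(φ_γ)`. -/
def MemFrechetDom (F : ℝ → ℝ) : Prop := ∃ γ, 0 < γ ∧ MemDomAttr F (frechetDF γ)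

/-- Membership in `D(ψ) = ⋃_{γ>0} D(ψ_γ)`. -/
def MemWeibullDom (F : ℝ → ℝ) : Prop := ∃ γ, 0 < γ ∧ MemDomAttr F (weibullDF γ)

/-- Membership in `Γ = D(Λ) ∪ D(φ) ∪ D(ψ)`. -/
def MemGamma (F : ℝ → ℝ) : Prop :=
  MemDomAttr F gumbelDF ∨ MemFrechetDom F ∨ MemWeibullDom F

/-- Iterated integral `x ↦ ∫_x^z dy_1 ∫_{y_1}^z ⋯ ∫_{y_p}^z (1 - H t) dt`. -/
def iterInt (H : ℝ → ℝ) (z : ℝ) : ℕ → ℝ → ℝ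
  | 0 => fun x => ∫ t in x..z, (1 - H t)
  | (p + 1) => fun x => ∫ y in x..z, iterInt H z p y

/-- `Rp p x z H` is `R_p(x, z, H)` (for `p ≥ 1`). -/
def Rp (p : ℕ) (x z : ℝ) (H : ℝ → ℝ) : ℝ := (1 - H x)⁻¹ * iterInt H z (p - 1) x

/-- Iterated integral with upper endpoint `x₀(H)` (handled as an integral up to +∞,
since `1 - H` vanishes beyond the upper endpoint). -/
def iterIntInf (H : ℝ → ℝ) : ℕ → ℝ → ℝ
  | 0 => fun x => ∫ t in Set.Ioi x, (1 - H t)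
  | (p + 1) => fun x => ∫ y in Set.Ioi x, iterIntInf H p y

/-- `RpInf p x H` is `R_p(x, H) = R_p(x, x₀(H), H)` (for `p ≥ 1`). -/
def RpInf (p : ℕ) (x : ℝ) (H : ℝ → ℝ) : ℝ := (1 - H x)⁻¹ * iterIntInf H (p - 1) x

/-- Regular variation at zero with exponent `d`. -/
def RegVarAtZero (s : ℝ → ℝ) (d : ℝ) : Prop :=
  ∀ l : ℝ, 0 < l → Tendsto (fun u => s (l * u) / s u) (𝓝[>] (0 : ℝ)) (𝓝 (l ^ d))

/-- `orderStat n j v`: the `j`-th smallest (1-indexed) among `v 0, …, v (n-1)`. -/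
def orderStat (n j : ℕ) (v : ℕ → ℝ) : ℝ :=
  ((Multiset.map v (Multiset.range n)).sort (· ≤ ·)).getD (j - 1) 0

/-- Cumulative distribution function of the centered Gaussian law with variance `v`. -/
def gaussCdf (v : ℝ) (x : ℝ) : ℝ :=
  ((ProbabilityTheory.gaussianReal 0 v.toNNReal) (Set.Iic x)).toReal


open Classical in
/-- The filter "x → x₀(G)⁻" of approach to the upper endpoint from below
(`atTop` when the upper endpoint is infinite). -/
def upEndFilter (G : ℝ → ℝ) : Filter ℝ :=
  if BddAbove {x | G x < 1} then 𝓝[<] (upEnd G) else atTop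


/-- Decay propagation property. -/
def CP (S : ℝ → ℝ) (ε δ η : ℝ) : Prop :=
  ∃ ρ > 0, ∀ x z, x < z → 0 < S z → S z ≤ ρ → S z ≤ ε * S x → S (z + δ * (z - x)) ≤ η * S z

def Good (S : ℝ → ℝ) : Prop :=
  (∃ ε0 > 0, ∀ ε, 0 < ε → ε < ε0 → CP S ε 2 ε) ∧ ∀ δ > 0, ∀ η > 0, ∃ ε > 0, CP S ε δ η

lemma CP_log {T : ℝ → ℝ} (hT : Antitone T) {ε δ η : ℝ} (hδ : 0 ≤ δ) (h : CP T ε δ η) :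
    CP (fun x => T (Real.exp x)) ε δ η := by
  obtain ⟨ρ, hρ, h⟩ := h
  refine ⟨ρ, hρ, fun x z hxz h0 h1 h2 => ?_⟩
  refine le_trans (hT ?_) (h (Real.exp x) (Real.exp z) (Real.exp_lt_exp.2 hxz) h0 h1 h2)
  have e1 : Real.exp (z + δ * (z - x)) = Real.exp z * Real.exp (δ * (z - x)) := Real.exp_add _ _
  have e2 : Real.exp x = Real.exp z * Real.exp (-(z - x)) := by
    rw [← Real.exp_add]; congr 1; ring
  have e3 := Real.add_one_le_exp (δ * (z - x))
  have e4 := Real.add_one_le_exp (-(z - x))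
  rw [e1, e2]
  have hz := Real.exp_pos z
  have : Real.exp z + δ * (Real.exp z - Real.exp z * Real.exp (-(z - x))) =
    Real.exp z * (1 + δ * (1 - Real.exp (-(z - x)))) := by ring
  rw [this]
  apply mul_le_mul_of_nonneg_left _ hz.le
  nlinarith [mul_le_mul_of_nonneg_left e4 hδ]

lemma Good_log {T : ℝ → ℝ} (hT : Antitone T) (h : Good T) : Good (fun x => T (Real.exp x)) := by
  obtain ⟨⟨e, he, h1⟩, h2⟩ := h
  refine ⟨⟨e, he, fun ε h0 h3 => CP_log hT (by norm_num) (h1 ε h0 h3)⟩, fun δ hδ η hη => ?_⟩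
  obtain ⟨ε, h0, h3⟩ := h2 δ hδ η hη
  exact ⟨ε, h0, CP_log hT hδ.le h3⟩

lemma CP_of_seq {T : ℝ → ℝ} (hT : Antitone T) (hT1 : ∀ x, T x ≤ 1)
    (α β : ℕ → ℝ) (hα : ∀ k, 0 < α k) {ε δ η w p tw tp tr : ℝ} (hε : 0 < ε) (hδ : 0 ≤ δ)
    (hη : 0 < η)
    (hw : Tendsto (fun k : ℕ => (2:ℝ) ^ k * T (α k * w + β k)) atTop (𝓝 tw)) (hw' : tw < 1 / ε)
    (hp : Tendsto (fun k : ℕ => (2:ℝ) ^ k * T (α k * p + β k)) atTop (𝓝 tp)) (hp' : 2 < tp)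
    (hr : Tendsto (fun k : ℕ => (2:ℝ) ^ k * T (α k * (p + δ * (p - w)) + β k)) atTop (𝓝 tr))
    (hr' : tr < η) : CP T ε δ η := by
  have := (hw.eventually_lt_const hw').and ((hp.eventually_const_lt hp').and
    (hr.eventually_lt_const hr'))
  obtain ⟨k0, hk0⟩ := eventually_atTop.1 this
  refine ⟨1 / 2 ^ k0, by positivity, fun x z hxz h0 h1 h2 => ?_⟩
  obtain ⟨k, hk1, hk2⟩ := exists_nat_pow_near (x := 1 / T z) (y := (2:ℝ))
    (by rw [le_div_iff₀ h0]; simpa using hT1 z) (by norm_num)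
  -- 2^k ≤ 1/T z < 2^(k+1)
  have hk : k0 ≤ k + 1 := by
    have : (2:ℝ) ^ k0 < 2 ^ (k + 1) := by
      refine lt_of_le_of_lt ?_ hk2
      rw [le_div_iff₀ h0]
      rw [le_div_iff₀ (by positivity)] at h1
      linarith
    exact ((pow_lt_pow_iff_right₀ (by norm_num)).1 this).le
  obtain ⟨h3, h4, h5⟩ := hk0 (k + 1) hk
  rw [div_lt_iff₀ h0] at hk2
  rw [le_div_iff₀ h0] at hk1
  set K : ℝ := 2 ^ (k + 1) with hK
  have hKe : K = 2 * 2 ^ k := by rw [hK, pow_succ]; ring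
  have hKpos : 0 < K := by positivity
  have hzp : α (k+1) * p + β (k+1) < z := by
    by_contra! hc
    have := mul_le_mul_of_nonneg_left (hT hc) hKpos.le
    nlinarith
  have hxw : x < α (k+1) * w + β (k+1) := by
    by_contra! hc
    have h6 := mul_le_mul_of_nonneg_left (hT hc) hKpos.le
    have h7 : K * T x < 1 / ε := lt_of_le_of_lt h6 h3
    rw [lt_div_iff₀ hε] at h7
    nlinarith [mul_le_mul_of_nonneg_left h2 hKpos.le]
  have h8 : α (k+1) * (p + δ * (p - w)) + β (k+1) ≤ z + δ * (z - x) := by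
    have : α (k+1) * (p - w) ≤ z - x := by nlinarith
    nlinarith [mul_le_mul_of_nonneg_left this hδ]
  have h9 := mul_le_mul_of_nonneg_left (hT h8) hKpos.le
  have h10 : K * T (z + δ * (z - x)) ≤ K * (η * T z) := by
    have : η * 1 ≤ η * (K * T z) := mul_le_mul_of_nonneg_left hk2.le hη.le
    nlinarith
  exact le_of_mul_le_mul_left h10 hKpos

lemma Good_exp {T : ℝ → ℝ} (hT : Antitone T) (hT1 : ∀ x, T x ≤ 1)
    (α β : ℕ → ℝ) (hα : ∀ k, 0 < α k)
    (h : ∀ y, Tendsto (fun k : ℕ => (2:ℝ) ^ k * T (α k * y + β k)) atTop (𝓝 (Real.exp (-y)))) :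
    Good T := by
  have key : ∀ L δ η : ℝ, 0 ≤ δ → 0 < η → Real.exp (-(-1 + δ * (L - 2))) < η →
      CP T (Real.exp (-L)) δ η := by
    intro L δ η hδ hη hL
    refine CP_of_seq hT hT1 α β hα (w := 1 - L) (p := -1) (Real.exp_pos _) hδ hη (h _) ?_ (h _) ?_
      (h _) ?_
    · rw [one_div, ← Real.exp_neg, Real.exp_lt_exp]; linarith
    · have := Real.exp_one_gt_d9
      rw [neg_neg]; linarith
    · convert hL using 3; ring
  refine ⟨⟨Real.exp (-5), Real.exp_pos _, fun ε h0 h1 => ?_⟩, fun δ hδ η hη => ?_⟩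
  · have e : ε = Real.exp (-(-Real.log ε)) := by rw [neg_neg, Real.exp_log h0]
    have h2 : Real.log ε < -5 := by rw [Real.log_lt_iff_lt_exp h0]; exact h1
    have := key (-Real.log ε) 2 ε (by norm_num) h0 (by
      rw [← Real.lt_log_iff_exp_lt h0]; linarith)
    rwa [← e] at this
  · refine ⟨_, Real.exp_pos _, key (2 + (2 - Real.log η) / δ) δ η hδ.le hη ?_⟩
    rw [← Real.lt_log_iff_exp_lt hη]
    field_simp
    linarith

lemma Good_weibull {T : ℝ → ℝ} (hT : Antitone T) (hT1 : ∀ x, T x ≤ 1)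
    (α β : ℕ → ℝ) (hα : ∀ k, 0 < α k) {γ : ℝ} (hγ : 0 < γ)
    (h : ∀ y < 0, Tendsto (fun k : ℕ => (2:ℝ) ^ k * T (α k * y + β k)) atTop (𝓝 ((-y) ^ γ)))
    (h' : ∀ y > 0, Tendsto (fun k : ℕ => (2:ℝ) ^ k * T (α k * y + β k)) atTop (𝓝 0)) :
    Good T := by
  set p : ℝ := (4:ℝ) ^ (γ⁻¹) with hp
  have hp0 : 0 < p := by positivity
  have key : ∀ ε v δ η : ℝ, 0 ≤ δ → 0 < η → 0 < ε → 0 < v → v ^ γ < 1 / ε → 0 < -p + δ * (v - p) →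
      CP T ε δ η := by
    intro ε v δ η hδ hη hε hv h1 h2
    refine CP_of_seq hT hT1 α β hα (w := -v) (p := -p) hε hδ hη (h _ (by linarith)) ?_
      (h _ (by linarith)) ?_ (h' _ ?_) hη
    · rwa [neg_neg]
    · rw [neg_neg, hp, Real.rpow_inv_rpow (by norm_num) hγ.ne']; norm_num
    · convert h2 using 1; ring
  refine ⟨⟨1 / (2 * p) ^ γ, by positivity, fun ε h0 h1 => ?_⟩, fun δ hδ η hη => ?_⟩
  · apply key ε (2 * p) 2 ε (by norm_num) h0 h0 (by positivity)
    · rw [lt_div_iff₀ (by positivity)] at h1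
      rw [lt_div_iff₀ h0]; linarith
    · linarith
  · have hv : 0 < p + 2 * p / δ := by positivity
    refine ⟨1 / (2 * (p + 2 * p / δ) ^ γ), by positivity, key _ (p + 2 * p / δ) δ η hδ.le hη
      (by positivity) hv ?_ ?_⟩
    · have := Real.rpow_pos_of_pos hv γ
      rw [one_div_one_div]; linarith
    · field_simp; linarith

lemma tail_of_pow {F : ℝ → ℝ} (hF : ∀ x, 0 ≤ F x ∧ F x ≤ 1) (u : ℕ → ℝ) {M : ℝ} (hM : 0 < M)
    (h : Tendsto (fun n => F (u n) ^ n) atTop (𝓝 M)) :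
    Tendsto (fun n : ℕ => (n:ℝ) * (1 - F (u n))) atTop (𝓝 (-Real.log M)) := by
  have h1 : Tendsto (fun n : ℕ => (n:ℝ) * Real.log (F (u n))) atTop (𝓝 (Real.log M)) := by
    have := h.log hM.ne'
    simpa [Real.log_pow] using this
  have hpos : ∀ᶠ n : ℕ in atTop, 0 < F (u n) := by
    filter_upwards [h.eventually_const_lt hM, eventually_ge_atTop 1] with n hn hn1
    rcases (hF (u n)).1.lt_or_eq with h | h
    · exact h
    · rw [← h, zero_pow (by omega)] at hn; exact absurd hn (lt_irrefl _)
  have h2 : Tendsto (fun n : ℕ => Real.log (F (u n))) atTop (𝓝 0) := by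
    have := h1.mul (tendsto_inv_atTop_nhds_zero_nat (𝕜 := ℝ))
    rw [mul_zero] at this
    refine this.congr' ?_
    filter_upwards [eventually_ge_atTop 1] with n hn
    have : (n:ℝ) ≠ 0 := by positivity
    field_simp
  have h3 : Tendsto (fun n : ℕ => F (u n)) atTop (𝓝 1) := by
    have := (Real.continuous_exp.tendsto 0).comp h2
    rw [Real.exp_zero] at this
    refine this.congr' ?_
    filter_upwards [hpos] with n hn
    simp [Real.exp_log hn]
  have h4 := h1.neg
  have h5 := h3.mul h4
  rw [one_mul] at h5
  refine tendsto_of_tendsto_of_tendsto_of_le_of_le' h5 h4 ?_ ?_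
  · filter_upwards [hpos] with n hn
    have := Real.one_sub_inv_le_log_of_pos hn
    have h6 : F (u n) * (1 - (F (u n))⁻¹) ≤ F (u n) * Real.log (F (u n)) :=
      mul_le_mul_of_nonneg_left this hn.le
    rw [mul_sub, mul_inv_cancel₀ hn.ne'] at h6
    have := mul_le_mul_of_nonneg_left h6 (Nat.cast_nonneg (α := ℝ) n)
    nlinarith
  · filter_upwards [hpos] with n hn
    have := Real.log_le_sub_one_of_pos hn
    have := mul_le_mul_of_nonneg_left this (Nat.cast_nonneg (α := ℝ) n)
    linarith

lemma contr_tendsto {u : ℕ → ℝ} {q : ℝ} (hq0 : 0 ≤ q) (hq : q < 1) (hu : ∀ k, 0 ≤ u k)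
    (h : ∀ e > 0, ∀ᶠ k in atTop, u (k + 1) ≤ q * u k + e) : Tendsto u atTop (𝓝 0) := by
  rw [tendsto_order]
  refine ⟨fun a ha => Eventually.of_forall fun k => lt_of_lt_of_le ha (hu k), fun a ha => ?_⟩
  have hq' : 0 < 1 - q := by linarith
  obtain ⟨k0, hk0⟩ := eventually_atTop.1 (h (a / 2 * (1 - q)) (by positivity))
  have hb : ∀ j, u (k0 + j) ≤ q ^ j * u k0 + a / 2 := by
    intro j
    induction j with
    | zero => simp; linarith
    | succ j ih =>
      have h1 := hk0 (k0 + j) (by omega)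
      have h2 := mul_le_mul_of_nonneg_left ih hq0
      rw [← add_assoc, pow_succ]
      nlinarith
  have ht : Tendsto (fun j : ℕ => q ^ j * u k0) atTop (𝓝 (0 * u k0)) :=
    (tendsto_pow_atTop_nhds_zero_of_lt_one hq0 hq).mul_const _
  rw [zero_mul] at ht
  obtain ⟨j0, hj0⟩ := eventually_atTop.1 (ht.eventually_lt_const (half_pos ha))
  filter_upwards [eventually_ge_atTop (k0 + j0)] with k hk
  obtain ⟨j, rfl⟩ := Nat.exists_eq_add_of_le (show k0 ≤ k by omega)
  have := hb j
  have := hj0 j (by omega)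
  linarith

lemma frechet_between {T : ℝ → ℝ} (hT : Antitone T) (A B : ℕ → ℝ) {γ : ℝ} (hγ : 0 < γ)
    (h : ∀ y > 0, Tendsto (fun k : ℕ => (2:ℝ) ^ k * T (A k * y + B k)) atTop (𝓝 (y ^ (-γ))))
    {y θ : ℝ} (hy : 0 < y) (hθ : 0 < θ) (hθ' : θ < (2:ℝ) ^ γ⁻¹ * y) :
    ∀ᶠ k in atTop, A k * ((2:ℝ) ^ γ⁻¹ * y - θ) + B k < A (k+1) * y + B (k+1) ∧
      A (k+1) * y + B (k+1) < A k * ((2:ℝ) ^ γ⁻¹ * y + θ) + B k := by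
  set c : ℝ := (2:ℝ) ^ γ⁻¹ with hc
  have hc0 : 0 < c := by positivity
  have h0 := (h y hy).comp (tendsto_add_atTop_nat 1)
  have e : y ^ (-γ) = 2 * (c * y) ^ (-γ) := by
    rw [Real.mul_rpow hc0.le hy.le, Real.rpow_neg hc0.le, hc,
      Real.rpow_inv_rpow (by norm_num) hγ.ne']
    ring
  have h1 := (h (c * y - θ) (by linarith)).const_mul 2
  have h2 := (h (c * y + θ) (by positivity)).const_mul 2
  have l1 : y ^ (-γ) < 2 * (c * y - θ) ^ (-γ) := by
    rw [e]
    have := Real.rpow_lt_rpow_of_neg (x := c * y - θ) (y := c * y) (z := -γ) (by linarith)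
      (by linarith) (by linarith)
    linarith
  have l2 : 2 * (c * y + θ) ^ (-γ) < y ^ (-γ) := by
    rw [e]
    have := Real.rpow_lt_rpow_of_neg (x := c * y) (y := c * y + θ) (z := -γ) (by positivity)
      (by linarith) (by linarith)
    linarith
  filter_upwards [h0.eventually_lt h1 l1, h2.eventually_lt h0 l2] with k k1 k2
  simp only [Function.comp, pow_succ] at k1 k2
  have hk : (0:ℝ) < 2 ^ k := by positivity
  constructor
  · by_contra! hcon
    have := mul_le_mul_of_nonneg_left (hT hcon) hk.le
    linarith
  · by_contra! hcon
    have := mul_le_mul_of_nonneg_left (hT hcon) hk.le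
    linarith

lemma frechet_ratio {T : ℝ → ℝ} (hT : Antitone T) (A B : ℕ → ℝ) (hA : ∀ k, 0 < A k)
    {γ : ℝ} (hγ : 0 < γ)
    (h : ∀ y > 0, Tendsto (fun k : ℕ => (2:ℝ) ^ k * T (A k * y + B k)) atTop (𝓝 (y ^ (-γ)))) :
    Tendsto (fun k => |B k / A k|) atTop (𝓝 0) := by
  set c : ℝ := (2:ℝ) ^ γ⁻¹ with hc
  have hc1 : 1 < c := Real.one_lt_rpow (by norm_num) (by positivity)
  apply contr_tendsto (q := 2 / (c + 1)) (by positivity)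
    (by rw [div_lt_one (by linarith)]; linarith) (fun k => abs_nonneg _)
  intro e he
  obtain ⟨θ, hθ0, hθ1, hθ2⟩ : ∃ θ : ℝ, 0 < θ ∧ θ ≤ (c - 1) / 4 ∧ 3 * θ ≤ e := by
    refine ⟨min ((c - 1) / 4) (e / 3), lt_min (by linarith) (by linarith), min_le_left _ _, ?_⟩
    have := min_le_right ((c - 1) / 4) (e / 3)
    linarith
  filter_upwards [frechet_between hT A B hγ h (y := 1) (θ := θ) one_pos hθ0 (by linarith),
    frechet_between hT A B hγ h (y := 2) (θ := θ) two_pos hθ0 (by linarith)] with k k1 k2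
  rw [← hc] at k1 k2
  have hAk := hA k
  have hAk1 := hA (k+1)
  have a1 : A k * ((c + 1) / 2) ≤ A (k+1) := by nlinarith
  have b1 : |B (k+1)| ≤ |B k| + 3 * θ * A k := by
    have : |B (k+1) - B k| ≤ 3 * θ * A k := by
      rw [abs_le]; constructor <;> nlinarith
    have := abs_sub_abs_le_abs_sub (B (k+1)) (B k)
    linarith
  rw [abs_div, abs_div, abs_of_pos hAk, abs_of_pos hAk1, div_le_iff₀ hAk1]
  have hq : 0 ≤ 2 / (c + 1) * (|B k| / A k) + e := by positivity
  have h3 := mul_le_mul_of_nonneg_left a1 hq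
  refine le_trans ?_ h3
  have : (2 / (c + 1) * (|B k| / A k) + e) * (A k * ((c + 1) / 2)) =
    |B k| + e * A k * ((c + 1) / 2) := by
    field_simp
  rw [this]
  have : 3 * θ * A k ≤ e * A k * ((c + 1) / 2) := by
    have : 3 * θ * A k ≤ e * A k := mul_le_mul_of_nonneg_right hθ2 hAk.le
    have h5 : 0 < e * A k := by positivity
    nlinarith
  linarith

lemma Good_frechet {T : ℝ → ℝ} (hT : Antitone T) (hT1 : ∀ x, T x ≤ 1)
    (A B : ℕ → ℝ) (hA : ∀ k, 0 < A k)
    {γ : ℝ} (hγ : 0 < γ)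
    (h : ∀ y > 0, Tendsto (fun k : ℕ => (2:ℝ) ^ k * T (A k * y + B k)) atTop (𝓝 (y ^ (-γ)))) :
    Good (fun x => T (Real.exp x)) := by
  have hr := frechet_ratio hT A B hA hγ h
  have hS : Antitone (fun x => T (Real.exp x)) := fun a b hab => hT (Real.exp_le_exp.2 hab)
  apply Good_exp hS (fun x => hT1 _) (fun _ => γ⁻¹) (fun k => Real.log (A k))
    (fun _ => by positivity)
  intro y
  set v : ℝ := Real.exp (γ⁻¹ * y) with hv
  have hv0 : 0 < v := Real.exp_pos _
  have ev : Real.exp (-y) = v ^ (-γ) := by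
    rw [hv, ← Real.exp_mul]; congr 1; field_simp
  have eT : ∀ k, Real.exp (γ⁻¹ * y + Real.log (A k)) = A k * v := by
    intro k; rw [Real.exp_add, Real.exp_log (hA k)]; ring
  simp only [eT, ev]
  have hcont : ContinuousAt (fun s : ℝ => s ^ (-γ)) v :=
    Real.continuousAt_rpow_const _ _ (Or.inl hv0.ne')
  have sq : ∀ θ > 0, ∀ᶠ k in atTop, A k * (v - θ) + B k ≤ A k * v ∧
      A k * v ≤ A k * (v + θ) + B k := by
    intro θ hθ
    filter_upwards [hr.eventually_lt_const hθ] with k hk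
    have hAk := hA k
    rw [abs_div, abs_of_pos hAk, div_lt_iff₀ hAk] at hk
    have := abs_lt.1 hk
    constructor <;> nlinarith
  rw [tendsto_order]
  constructor
  · intro a ha
    obtain ⟨r, hr0, hrb⟩ := Metric.eventually_nhds_iff.1 (hcont.eventually_const_lt ha)
    have h1 : a < (v + r / 2) ^ (-γ) := hrb (by simp [abs_of_pos hr0]; linarith)
    filter_upwards [sq (r / 2) (by positivity),
      (h (v + r / 2) (by positivity)).eventually_const_lt h1] with k k1 k2
    exact lt_of_lt_of_le k2 (mul_le_mul_of_nonneg_left (hT k1.2) (by positivity))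
  · intro a ha
    obtain ⟨r, hr0, hrb⟩ := Metric.eventually_nhds_iff.1 (hcont.eventually_lt_const ha)
    have hm : 0 < min (r / 2) (v / 2) := by positivity
    have hm1 := min_le_left (r / 2) (v / 2)
    have hm2 := min_le_right (r / 2) (v / 2)
    have h1 : (v - min (r / 2) (v / 2)) ^ (-γ) < a :=
      hrb (by rw [Real.dist_eq, sub_sub_cancel_left, abs_neg, abs_of_pos hm]; linarith)
    filter_upwards [sq _ hm,
      (h (v - min (r / 2) (v / 2)) (by linarith)).eventually_lt_const h1] with k k1 k2
    exact lt_of_le_of_lt (mul_le_mul_of_nonneg_left (hT k1.1) (by positivity)) k2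

lemma dom_seq {F M : ℝ → ℝ} (hF : ∀ x, 0 ≤ F x ∧ F x ≤ 1) (h : MemDomAttr F M) :
    ∃ A B : ℕ → ℝ, (∀ k, 0 < A k) ∧ ∀ y, ContinuousAt M y → 0 < M y →
      Tendsto (fun k : ℕ => (2:ℝ) ^ k * (1 - F (A k * y + B k))) atTop (𝓝 (-Real.log (M y))) := by
  obtain ⟨a, b, ha, h⟩ := h
  refine ⟨fun k => a (2 ^ k), fun k => b (2 ^ k), fun k => ha _, fun y hy hM => ?_⟩
  have h1 := tail_of_pow hF (fun n => a n * y + b n) hM (h y hy)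
  have h2 := h1.comp (tendsto_pow_atTop_atTop_of_one_lt (r := (2:ℕ)) (by norm_num))
  refine h2.congr fun k => ?_
  simp

lemma Good_of_gamma {F : ℝ → ℝ} (hF : IsDF F) (hΓ : MemGamma F) :
    Good (fun x => 1 - F (Real.exp x)) := by
  obtain ⟨hm, -, h0, h1⟩ := hF
  have hb : ∀ x, 0 ≤ F x ∧ F x ≤ 1 := fun x =>
    ⟨hm.le_of_tendsto h0 x, hm.ge_of_tendsto h1 x⟩
  have hT : Antitone (fun x => 1 - F x) := fun a b hab => sub_le_sub_left (hm hab) 1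
  have hT1 : ∀ x, (fun x => 1 - F x) x ≤ 1 := fun x => by simpa using (hb x).1
  rcases hΓ with h | ⟨γ, hγ, h⟩ | ⟨γ, hγ, h⟩
  · obtain ⟨A, B, hA, h⟩ := dom_seq hb h
    refine Good_log hT (Good_exp hT hT1 A B hA fun y => ?_)
    have := h y (by unfold gumbelDF; fun_prop) (Real.exp_pos _)
    simpa [gumbelDF] using this
  · obtain ⟨A, B, hA, h⟩ := dom_seq hb h
    refine Good_frechet hT hT1 A B hA hγ fun y hy => ?_
    have e : frechetDF γ =ᶠ[𝓝 y] fun x => Real.exp (-(x ^ (-γ))) := by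
      filter_upwards [lt_mem_nhds hy] with x hx
      simp [frechetDF, hx]
    have hc : ContinuousAt (frechetDF γ) y := by
      refine ContinuousAt.congr ?_ e.symm
      exact Real.continuous_exp.continuousAt.comp
        (Real.continuousAt_rpow_const _ _ (Or.inl hy.ne')).neg
    have := h y hc (by simp [frechetDF, hy, Real.exp_pos])
    simpa [frechetDF, hy] using this
  · obtain ⟨A, B, hA, h⟩ := dom_seq hb h
    refine Good_log hT (Good_weibull hT hT1 A B hA hγ (fun y hy => ?_) fun y hy => ?_)
    · have e : weibullDF γ =ᶠ[𝓝 y] fun x => Real.exp (-((-x) ^ γ)) := by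
        filter_upwards [gt_mem_nhds hy] with x hx
        simp [weibullDF, hx]
      have hc : ContinuousAt (weibullDF γ) y := by
        refine ContinuousAt.congr ?_ e.symm
        exact Real.continuous_exp.continuousAt.comp
          ((Real.continuousAt_rpow_const (-y) γ (Or.inr hγ.le)).comp
            continuous_neg.continuousAt).neg
      have := h y hc (by simp [weibullDF, hy, Real.exp_pos])
      simpa [weibullDF, hy] using this
    · have e : weibullDF γ =ᶠ[𝓝 y] fun x => 1 := by
        filter_upwards [lt_mem_nhds hy] with x hx
        simp [weibullDF, hx.not_gt]
      have hc : ContinuousAt (weibullDF γ) y := ContinuousAt.congr continuousAt_const e.symm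
      have := h y hc (by simp [weibullDF, hy.not_gt])
      simpa [weibullDF, hy.not_gt] using this

def fI (S : ℝ → ℝ) : ℕ → ℝ → ℝ
  | 0 => S
  | (q + 1) => fun y => ∫ t in Set.Ioi y, fI S q t

def jI (S : ℝ → ℝ) (z : ℝ) : ℕ → ℝ → ℝ
  | 0 => S
  | (q + 1) => fun y => ∫ t in y..z, jI S z q t

lemma fI_eq (G : ℝ → ℝ) (q : ℕ) : iterIntInf G q = fI (fun x => 1 - G x) (q + 1) := by
  induction q with
  | zero => rfl
  | succ q ih => simp only [iterIntInf, ih]; rfl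

lemma jI_eq (G : ℝ → ℝ) (z : ℝ) (q : ℕ) : iterInt G z q = jI (fun x => 1 - G x) z (q + 1) := by
  induction q with
  | zero => rfl
  | succ q ih => simp only [iterInt, ih]; rfl

lemma kernel_int {z d y : ℝ} (hd : 0 < d) (hy : z ≤ y) {k : ℕ} (hk : 1 ≤ k) :
    IntegrableOn (fun t => (d / (t - z + d)) ^ (k + 1)) (Ioi y) ∧
      ∫ t in Ioi y, (d / (t - z + d)) ^ (k + 1) ≤ d * (d / (y - z + d)) ^ k := by
  have hk0 : (0:ℝ) < k := by exact_mod_cast hk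
  have hder : ∀ t ∈ Ici y, HasDerivAt (fun t => -(d / k) * (d / (t - z + d)) ^ k)
      ((d / (t - z + d)) ^ (k + 1)) t := by
    intro t ht
    have hs : 0 < t - z + d := by have : y ≤ t := ht; linarith
    have h1 : HasDerivAt (fun t => t - z + d) 1 t := ((hasDerivAt_id t).sub_const z).add_const d
    have h2 := (((h1.inv hs.ne').const_mul d).pow k).const_mul (-(d / k))
    refine HasDerivAt.congr_deriv (f' := _) (by simpa [div_eq_mul_inv] using h2) ?_
    obtain ⟨m, rfl⟩ := Nat.exists_eq_add_of_le' hk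
    simp only [Nat.add_sub_cancel]
    simp only [div_eq_mul_inv, pow_succ, mul_pow]
    field_simp
  have hpos : ∀ t ∈ Ioi y, 0 ≤ (d / (t - z + d)) ^ (k + 1) := by
    intro t ht
    have hs : 0 < t - z + d := by have : y < t := ht; linarith
    positivity
  have hlim : Tendsto (fun t => -(d / k) * (d / (t - z + d)) ^ k) atTop (𝓝 0) := by
    have h1 : Tendsto (fun t : ℝ => t - z + d) atTop atTop := by
      simp only [sub_eq_add_neg]
      exact tendsto_atTop_add_const_right _ _ (tendsto_atTop_add_const_right _ _ tendsto_id)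
    have h2 := ((h1.const_div_atTop d).pow k).const_mul (-(d / k))
    simpa [zero_pow (show k ≠ 0 by omega)] using h2
  refine ⟨integrableOn_Ioi_deriv_of_nonneg' hder hpos hlim, ?_⟩
  rw [integral_Ioi_of_hasDerivAt_of_nonneg' hder hpos hlim]
  have hs : 0 < y - z + d := by linarith
  have : d / k ≤ d := div_le_self hd.le (by exact_mod_cast hk)
  have h3 : 0 ≤ (d / (y - z + d)) ^ k := by positivity
  nlinarith [mul_le_mul_of_nonneg_right this h3]

lemma antitone_integrableOn_Ioi {f : ℝ → ℝ} (hf : Antitone f) {z : ℝ}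
    (h : IntegrableOn f (Ioi z)) (y : ℝ) : IntegrableOn f (Ioi y) := by
  rcases le_total z y with hzy | hzy
  · exact h.mono_set (Ioi_subset_Ioi hzy)
  · rw [← Ioc_union_Ioi_eq_Ioi hzy]
    refine IntegrableOn.union ?_ h
    rw [← intervalIntegrable_iff_integrableOn_Ioc_of_le hzy]
    exact hf.intervalIntegrable

lemma fI_main {S : ℝ → ℝ} (hS : Antitone S) (hS0 : ∀ x, 0 ≤ S x) {z d : ℝ} (hd : 0 < d) {m : ℕ}
    (hE : ∀ k : ℕ, S (z + (2 ^ k - 1) * d) ≤ ((1/2) ^ m) ^ k * S z) (q : ℕ) :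
    q + 2 ≤ m → Antitone (fI S q) ∧ (∀ y, 0 ≤ fI S q y) ∧
      (∀ y, IntegrableOn (fI S q) (Ioi y)) ∧
      ∀ y, z ≤ y → fI S q y ≤ 2 ^ m * S z * d ^ q * (d / (y - z + d)) ^ (m - q) := by
  have hint : ∀ q, q + 2 ≤ m → Antitone (fI S q) → (∀ y, 0 ≤ fI S q y) →
      (∀ y, z ≤ y → fI S q y ≤ 2 ^ m * S z * d ^ q * (d / (y - z + d)) ^ (m - q)) →
      ∀ y, IntegrableOn (fI S q) (Ioi y) := by
    intro q hq ha h0 hb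
    apply antitone_integrableOn_Ioi ha (z := z)
    obtain ⟨k, hk⟩ := Nat.exists_eq_add_of_le hq
    have e : m - q = (k + 1) + 1 := by omega
    rw [e] at hb
    refine Integrable.mono' ((kernel_int hd le_rfl (k := k + 1) (by omega)).1.const_mul
      (2 ^ m * S z * d ^ q)) ha.measurable.aestronglyMeasurable ?_
    filter_upwards [ae_restrict_mem measurableSet_Ioi] with t ht
    rw [Real.norm_of_nonneg (h0 t)]
    exact hb t (le_of_lt ht)
  induction q with
  | zero =>
    intro hq
    have hb : ∀ y, z ≤ y → fI S 0 y ≤ 2 ^ m * S z * d ^ 0 * (d / (y - z + d)) ^ (m - 0) := by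
      intro y hy
      have hs : 0 < y - z + d := by linarith
      obtain ⟨k, hk1, hk2⟩ := exists_nat_pow_near (x := (y - z + d) / d) (y := (2:ℝ))
        (by rw [le_div_iff₀ hd]; linarith) (by norm_num)
      rw [le_div_iff₀ hd] at hk1
      rw [div_lt_iff₀ hd] at hk2
      have h1 : S y ≤ ((1/2) ^ m) ^ k * S z := le_trans (hS (by nlinarith)) (hE k)
      have h2 : (1/2 : ℝ) ^ (k + 1) ≤ d / (y - z + d) := by
        rw [one_div, inv_pow, inv_eq_one_div, div_le_div_iff₀ (by positivity) hs]
        linarith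
      have h3 : ((1/2 : ℝ) ^ (k + 1)) ^ m ≤ (d / (y - z + d)) ^ m :=
        pow_le_pow_left₀ (by positivity) h2 m
      have h4 : ((1/2 : ℝ) ^ m) ^ k = 2 ^ m * ((1/2 : ℝ) ^ (k + 1)) ^ m := by
        rw [pow_succ, mul_pow, ← pow_mul, ← pow_mul, mul_comm m k]
        have : (2:ℝ) ^ m * (1/2) ^ m = 1 := by rw [← mul_pow]; norm_num
        linear_combination (-(1/2) ^ (k * m)) * this
      simp only [fI, pow_zero, mul_one, Nat.sub_zero]
      calc S y ≤ 2 ^ m * ((1/2 : ℝ) ^ (k + 1)) ^ m * S z := by rw [← h4]; exact h1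
        _ ≤ 2 ^ m * (d / (y - z + d)) ^ m * S z := by
          apply mul_le_mul_of_nonneg_right _ (hS0 z)
          exact mul_le_mul_of_nonneg_left h3 (by positivity)
        _ = _ := by ring
    exact ⟨hS, hS0, hint 0 hq hS hS0 hb, hb⟩
  | succ q ih =>
    intro hq
    obtain ⟨ha, h0, hi, hb⟩ := ih (by omega)
    have h0' : ∀ y, 0 ≤ fI S (q+1) y := fun y =>
      setIntegral_nonneg measurableSet_Ioi fun t _ => h0 t
    have ha' : Antitone (fI S (q+1)) := fun y y' hyy' =>
      setIntegral_mono_set (hi y) (Eventually.of_forall h0)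
        (Ioi_subset_Ioi hyy').eventuallyLE
    have hb' : ∀ y, z ≤ y →
        fI S (q+1) y ≤ 2 ^ m * S z * d ^ (q+1) * (d / (y - z + d)) ^ (m - (q+1)) := by
      intro y hy
      obtain ⟨k, hk⟩ := Nat.exists_eq_add_of_le hq
      have e : m - q = (k + 2) + 1 := by omega
      have e' : m - (q+1) = k + 2 := by omega
      rw [e] at hb
      rw [e']
      have hK := kernel_int hd hy (k := k + 2) (by omega)
      calc fI S (q+1) y = ∫ t in Ioi y, fI S q t := rfl
        _ ≤ ∫ t in Ioi y, 2 ^ m * S z * d ^ q * (d / (t - z + d)) ^ ((k + 2) + 1) := by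
          refine setIntegral_mono_on (hi y) (hK.1.const_mul _) measurableSet_Ioi fun t ht => ?_
          exact hb t (hy.trans (le_of_lt ht))
        _ = 2 ^ m * S z * d ^ q * ∫ t in Ioi y, (d / (t - z + d)) ^ ((k + 2) + 1) :=
          integral_const_mul _ _
        _ ≤ 2 ^ m * S z * d ^ q * (d * (d / (y - z + d)) ^ (k + 2)) :=
          mul_le_mul_of_nonneg_left hK.2 (by have := hS0 z; positivity)
        _ = _ := by ring
    exact ⟨ha', h0', hint (q+1) hq ha' h0' hb', hb'⟩

lemma fI_split {S : ℝ → ℝ} {q : ℕ} (hi : ∀ y, IntegrableOn (fI S q) (Ioi y)) {y z : ℝ}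
    (hyz : y ≤ z) : fI S (q+1) y = (∫ t in y..z, fI S q t) + fI S (q+1) z := by
  have := intervalIntegral.integral_interval_add_Ioi (hi y) (hi z)
  exact this.symm

lemma fI_step {S : ℝ → ℝ} {q : ℕ} (ha : Antitone (fI S q)) (h0 : ∀ y, 0 ≤ fI S q y)
    (hi : ∀ y, IntegrableOn (fI S q) (Ioi y)) {y z : ℝ}
    (hyz : y ≤ z) : (z - y) * fI S q z ≤ fI S (q+1) y := by
  rw [fI_split hi hyz]
  have h1 : ∫ t in y..z, fI S q z ≤ ∫ t in y..z, fI S q t :=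
    intervalIntegral.integral_mono_on hyz intervalIntegrable_const
      ha.intervalIntegrable fun t ht => ha ht.2
  rw [intervalIntegral.integral_const, smul_eq_mul] at h1
  have : 0 ≤ fI S (q+1) z := setIntegral_nonneg measurableSet_Ioi fun t _ => h0 t
  linarith

/-- nice up to level p -/
def NiceTo (S : ℝ → ℝ) (p : ℕ) : Prop := ∀ q ≤ p, Antitone (fI S q) ∧ (∀ y, 0 ≤ fI S q y) ∧
      (∀ y, IntegrableOn (fI S q) (Ioi y))

lemma fI_pos {S : ℝ → ℝ} {p : ℕ} (hn : NiceTo S p) (hr : ∀ y, 0 < S y → ∃ w > y, 0 < S w)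
    (q : ℕ) (hq : q ≤ p) : ∀ y, 0 < S y → 0 < fI S q y := by
  induction q with
  | zero => exact fun y hy => hy
  | succ q ih =>
    intro y hy
    obtain ⟨w, hw, hSw⟩ := hr y hy
    obtain ⟨ha, h0, hi⟩ := hn q (by omega)
    refine lt_of_lt_of_le ?_ (fI_step ha h0 hi (le_of_lt hw))
    exact mul_pos (sub_pos.2 hw) (ih (by omega) w hSw)

lemma fI_lower {S : ℝ → ℝ} {p : ℕ} (hn : NiceTo S p)
    (q : ℕ) (hq : q ≤ p) : ∃ c > 0, ∀ y z, y ≤ z → c * ((z - y) ^ q * S z) ≤ fI S q y := by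
  induction q with
  | zero => exact ⟨1, one_pos, fun y z h => by
    rw [pow_zero, one_mul, one_mul]; exact (hn 0 (by omega)).1 h⟩
  | succ q ih =>
    obtain ⟨c, hc, h⟩ := ih (by omega)
    obtain ⟨ha, h0, hi⟩ := hn q (by omega)
    refine ⟨c * (1/2) ^ (q + 1), by positivity, fun y z hyz => ?_⟩
    have h1 := fI_step ha h0 hi (show y ≤ (y + z) / 2 by linarith)
    refine le_trans ?_ h1
    have h2 := h ((y + z) / 2) z (by linarith)
    have h3 : 0 ≤ (y + z) / 2 - y := by linarith
    refine le_trans (le_of_eq ?_) (mul_le_mul_of_nonneg_left h2 h3)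
    have e1 : z - (y + z) / 2 = (1/2) * (z - y) := by ring
    have e2 : (y + z) / 2 - y = (1/2) * (z - y) := by ring
    rw [e1, e2, mul_pow]; ring

lemma jI_int {S : ℝ → ℝ} (hS : Antitone S) (z : ℝ) (q : ℕ) :
    ∀ a b, IntervalIntegrable (jI S z q) volume a b := by
  induction q with
  | zero => exact fun a b => hS.intervalIntegrable
  | succ q ih =>
    intro a b
    have hc : Continuous (jI S z (q+1)) := by
      have h1 := (intervalIntegral.continuous_primitive ih z).neg
      refine h1.congr fun y => ?_
      exact (intervalIntegral.integral_symm _ _).symm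
    exact hc.intervalIntegrable a b

lemma diff_bound {S : ℝ → ℝ} {p : ℕ} (hn : NiceTo S p) {x z κ : ℝ} (hxz : x < z)
    (hκ : 0 ≤ κ) (hb : ∀ q, 1 ≤ q → q ≤ p → fI S q z ≤ κ * (z - x) ^ q * S z)
    (q : ℕ) (hq : q ≤ p) : ∀ y, x ≤ y → y ≤ z → 0 ≤ fI S q y - jI S z q y ∧
      fI S q y - jI S z q y ≤ q * (κ * (z - x) ^ q * S z) := by
  have hS0 : 0 ≤ S z := (hn 0 (by omega)).2.1 z
  induction q with
  | zero => intro y _ _; simp [fI, jI]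
  | succ q ih =>
    intro y hxy hyz
    obtain ⟨ha, h0, hi⟩ := hn q (by omega)
    have e : fI S (q+1) y - jI S z (q+1) y =
        (∫ t in y..z, (fI S q t - jI S z q t)) + fI S (q+1) z := by
      rw [fI_split hi hyz, intervalIntegral.integral_sub ha.intervalIntegrable
        (jI_int (S := S) (hn 0 (by omega)).1 z q y z)]
      simp only [jI]; ring
    rw [e]
    have hz0 := (hn (q+1) hq).2.1 z
    have hz1 := hb (q+1) (by omega) hq
    have i1 : 0 ≤ ∫ t in y..z, (fI S q t - jI S z q t) :=
      intervalIntegral.integral_nonneg hyz fun t ht => (ih (by omega) t (hxy.trans ht.1) ht.2).1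
    have i2 : ∫ t in y..z, (fI S q t - jI S z q t) ≤ ∫ t in y..z, q * (κ * (z - x) ^ q * S z) :=
      intervalIntegral.integral_mono_on hyz (ha.intervalIntegrable.sub
        (jI_int (S := S) (hn 0 (by omega)).1 z q y z)) intervalIntegrable_const
        fun t ht => (ih (by omega) t (hxy.trans ht.1) ht.2).2
    rw [intervalIntegral.integral_const, smul_eq_mul] at i2
    refine ⟨by linarith, ?_⟩
    have hC : 0 ≤ q * (κ * (z - x) ^ q * S z) := by
      have : 0 ≤ z - x := by linarith
      positivity
    have i3 : (z - y) * (q * (κ * (z - x) ^ q * S z)) ≤ (z - x) * (q * (κ * (z - x) ^ q * S z)) :=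
      mul_le_mul_of_nonneg_right (by linarith) hC
    push_cast
    rw [pow_succ] at hz1 ⊢
    nlinarith

lemma chain {S : ℝ → ℝ} (hS : Antitone S) (hS0 : ∀ x, 0 ≤ S x) {e : ℝ} (he : 0 < e)
    {ρ : ℝ} (hC : ∀ x z, x < z → 0 < S z → S z ≤ ρ → S z ≤ e * S x → S (z + 2 * (z - x)) ≤ e * S z)
    {z d : ℝ} (hd : 0 < d) (hz : S z ≤ ρ) (h1 : S (z + d) ≤ e * S z) (k : ℕ) :
    S (z + (2 ^ k - 1) * d) ≤ e ^ k * S z := by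
  have step : ∀ k : ℕ, S (z + (2 ^ (k+1) - 1) * d) ≤ e * S (z + (2 ^ k - 1) * d) := by
    intro k
    induction k with
    | zero => convert h1 using 2 <;> ring_nf
    | succ k ih =>
      have hlt : z + (2 ^ k - 1) * d < z + (2 ^ (k+1) - 1) * d := by
        have : (0:ℝ) < 2 ^ k * d := by positivity
        rw [pow_succ]; nlinarith
      have hz1 : z ≤ z + (2 ^ (k+1) - 1) * d := by
        have : (1:ℝ) ≤ 2 ^ (k+1) := one_le_pow₀ (by norm_num)
        nlinarith
      have eq : z + (2 ^ (k+1+1) - 1) * d = z + (2 ^ (k+1) - 1) * d +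
          2 * (z + (2 ^ (k+1) - 1) * d - (z + (2 ^ k - 1) * d)) := by ring
      rcases (hS0 (z + (2 ^ (k+1) - 1) * d)).lt_or_eq with h | h
      · rw [eq]
        exact hC _ _ hlt h ((hS hz1).trans hz) ih
      · rw [← h, mul_zero, h]
        apply hS
        rw [eq]; linarith
  induction k with
  | zero => simp
  | succ k ih =>
    refine (step k).trans ?_
    rw [pow_succ]
    nlinarith [mul_le_mul_of_nonneg_left ih he.le]

lemma main_ev {S : ℝ → ℝ} (hS : Antitone S) (hS0 : ∀ x, 0 ≤ S x) (hS1 : ∀ x, S x ≤ 1)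
    (hG : Good S) (p : ℕ) (x z : ℕ → ℝ) (hxz : ∀ n, x n < z n) (hpos : ∀ᶠ n in atTop, 0 < S (z n))
    (hratio : Tendsto (fun n => S (z n) / S (x n)) atTop (𝓝 0)) {κ : ℝ} (hκ : 0 < κ) :
    ∀ᶠ n in atTop, NiceTo S p ∧
      ∀ q, 1 ≤ q → q ≤ p → fI S q (z n) ≤ κ * (z n - x n) ^ q * S (z n) := by
  obtain ⟨⟨ε0, hε0, hG1⟩, hG2⟩ := hG
  obtain ⟨m0, hm0⟩ := exists_pow_lt_of_lt_one hε0 (show (1/2 : ℝ) < 1 by norm_num)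
  set m := max m0 (p + 2) with hm
  have hmp : p + 2 ≤ m := le_max_right _ _
  have hm1 : (1/2 : ℝ) ^ m < ε0 :=
    lt_of_le_of_lt (pow_le_pow_of_le_one (by norm_num) (by norm_num) (le_max_left _ _)) hm0
  have he : 0 < (1/2 : ℝ) ^ m := by positivity
  obtain ⟨ρ1, hρ1, hC1⟩ := hG1 _ he hm1
  set δ : ℝ := min 1 (κ / 2 ^ m) with hδ
  have hδ0 : 0 < δ := by positivity
  have hδ1 : δ ≤ 1 := min_le_left _ _
  have hδ2 : 2 ^ m * δ ≤ κ := by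
    have : δ ≤ κ / 2 ^ m := min_le_right _ _
    rw [le_div_iff₀ (by positivity)] at this
    linarith
  obtain ⟨ε, hε, ρ2, hρ2, hC2⟩ := hG2 δ hδ0 _ he
  have hτ : 0 < min ε (min ρ1 ρ2) := by positivity
  filter_upwards [hpos, hratio.eventually_lt_const hτ] with n hn hr
  have hxn : 0 < S (x n) := lt_of_lt_of_le hn (hS (hxz n).le)
  rw [div_lt_iff₀ hxn] at hr
  have t1 := min_le_left ε (min ρ1 ρ2)
  have t2 := (min_le_right ε (min ρ1 ρ2)).trans (min_le_left ρ1 ρ2)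
  have t3 := (min_le_right ε (min ρ1 ρ2)).trans (min_le_right ρ1 ρ2)
  have r1 : S (z n) ≤ ε * S (x n) := hr.le.trans (mul_le_mul_of_nonneg_right t1 hxn.le)
  have r0 : S (z n) ≤ min ε (min ρ1 ρ2) := hr.le.trans (mul_le_of_le_one_right hτ.le (hS1 _))
  have h1 := hC2 _ _ (hxz n) hn (r0.trans t3) r1
  have hd : 0 < z n - x n := sub_pos.2 (hxz n)
  have hE := chain hS hS0 he hC1 (mul_pos hδ0 hd) (r0.trans t2) h1
  have hM := fI_main hS hS0 (mul_pos hδ0 hd) hE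
  refine ⟨fun q hq => ?_, fun q hq1 hq => ?_⟩
  · obtain ⟨a, b, c, -⟩ := hM q (by omega)
    exact ⟨a, b, c⟩
  · refine ((hM q (by omega)).2.2.2 (z n) le_rfl).trans ?_
    rw [sub_self, zero_add, div_self (mul_pos hδ0 hd).ne', one_pow, mul_one, mul_pow]
    have : δ ^ q ≤ δ := pow_le_of_le_one hδ0.le hδ1 (by omega)
    have h5 : 2 ^ m * δ ^ q ≤ κ := (mul_le_mul_of_nonneg_left this (by positivity)).trans hδ2
    have h6 : 0 ≤ (z n - x n) ^ q * S (z n) := by positivity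
    nlinarith [mul_le_mul_of_nonneg_right h5 h6]

lemma pos_of_filter {G : ℝ → ℝ} (hm : Monotone G) (h1 : ∀ x, G x ≤ 1) (hne : ∃ x, G x < 1) :
    ∀ᶠ x in upEndFilter G, 0 < 1 - G x := by
  unfold upEndFilter
  split_ifs with hb
  · filter_upwards [self_mem_nhdsWithin] with x hx
    obtain ⟨w, hw, hxw⟩ := exists_lt_of_lt_csSup (s := {x | G x < 1}) hne hx
    have := hm hxw.le
    have hw : G w < 1 := hw
    linarith
  · refine Eventually.of_forall fun x => ?_
    obtain ⟨w, hw, hxw⟩ := not_bddAbove_iff.1 hb x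
    have := hm hxw.le
    have hw : G w < 1 := hw
    linarith

/-- Lemma 4.2. -/
theorem lemma_4_2 (F : ℝ → ℝ) (hF : IsDF F) (hF1 : F 1 = 0) (hΓ : MemGamma F)
    (G : ℝ → ℝ) (hG : G = fun x => F (Real.exp x)) (p : ℕ) (hp : 1 ≤ p)
    (x z : ℕ → ℝ)
    (hx : Tendsto x atTop (upEndFilter G))
    (hz : Tendsto z atTop (upEndFilter G))
    (hxz : ∀ n, x n < z n)
    (hratio : Tendsto (fun n => (1 - G (z n)) / (1 - G (x n))) atTop (𝓝 0)) :
    Tendsto (fun n => (z n - x n) ^ p / RpInf p (z n) G) atTop atTop ∧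
    Tendsto (fun n => Rp p (x n) (z n) G / RpInf p (x n) G) atTop (𝓝 1) := by
  obtain ⟨hm, hrc, h0, h1⟩ := id hF
  have hb : ∀ x, 0 ≤ F x ∧ F x ≤ 1 := fun x =>
    ⟨hm.le_of_tendsto h0 x, hm.ge_of_tendsto h1 x⟩
  have hGm : Monotone G := by
    intro a b hab
    rw [hG]
    exact hm (Real.exp_le_exp.2 hab)
  have hGb : ∀ x, 0 ≤ G x ∧ G x ≤ 1 := by
    intro x; rw [hG]; exact hb _
  have hgood : Good (fun x => 1 - G x) := by
    rw [hG]; exact Good_of_gamma hF hΓ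
  have hrcS : ∀ y, 0 < 1 - G y → ∃ w > y, 0 < 1 - G w := by
    intro y hy
    have hc : ContinuousWithinAt G (Ici y) y := by
      rw [hG]
      exact (hrc (Real.exp y)).comp Real.continuous_exp.continuousWithinAt
        fun a ha => Real.exp_le_exp.2 ha
    have hc' : Tendsto G (𝓝[>] y) (𝓝 (G y)) := hc.mono_left (nhdsWithin_mono _ Ioi_subset_Ici_self)
    have h2 : ∀ᶠ w in 𝓝[>] y, G w < 1 := hc'.eventually_lt_const (by linarith)
    obtain ⟨w, hw1, hw2⟩ := (h2.and self_mem_nhdsWithin).exists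
    exact ⟨w, hw2, by linarith⟩
  have hposf := pos_of_filter hGm (fun x => (hGb x).2) ⟨0, by rw [hG]; simp [hF1]⟩
  have hzpos : ∀ᶠ n in atTop, 0 < 1 - G (z n) := hz.eventually hposf
  set S : ℝ → ℝ := fun x => 1 - G x with hSdef
  have hS : Antitone S := fun a b hab => sub_le_sub_left (hGm hab) 1
  have hS0 : ∀ x, 0 ≤ S x := fun x => sub_nonneg.2 (hGb x).2
  have hS1 : ∀ x, S x ≤ 1 := fun x => sub_le_self _ (hGb x).1
  have hev := fun κ : ℝ => fun hκ : 0 < κ =>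
    main_ev hS hS0 hS1 hgood p x z hxz hzpos hratio hκ
  obtain ⟨p', rfl⟩ := Nat.exists_eq_add_of_le' hp
  have eR : ∀ y, RpInf (p' + 1) y G = (S y)⁻¹ * fI S (p' + 1) y := by
    intro y
    simp only [RpInf, Nat.add_sub_cancel, fI_eq]
    rfl
  have eJ : ∀ y w, Rp (p' + 1) y w G = (S y)⁻¹ * jI S w (p' + 1) y := by
    intro y w
    simp only [Rp, Nat.add_sub_cancel, jI_eq]
    rfl
  have hnice : NiceTo S (p' + 1) := by
    obtain ⟨n, hn⟩ := (hev 1 one_pos).exists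
    exact hn.1
  have hfpos := fI_pos hnice hrcS (p' + 1) le_rfl
  constructor
  · rw [tendsto_atTop]
    intro K
    have hK : 0 < (|K| + 1)⁻¹ := by positivity
    filter_upwards [hev _ hK, hzpos] with n hn hzn
    have h2 := hn.2 (p' + 1) (by omega) le_rfl
    have h3 := hfpos (z n) hzn
    have hzn' : 0 < S (z n) := hzn
    rw [eR]
    have e : (z n - x n) ^ (p' + 1) / ((S (z n))⁻¹ * fI S (p' + 1) (z n)) =
        (z n - x n) ^ (p' + 1) * S (z n) / fI S (p' + 1) (z n) := by
      field_simp
    rw [e, le_div_iff₀ h3]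
    have h4 : (|K| + 1) * fI S (p' + 1) (z n) ≤ (z n - x n) ^ (p' + 1) * S (z n) := by
      rw [mul_assoc, ← div_eq_inv_mul, le_div_iff₀ (by positivity)] at h2
      linarith
    have h5 : K * fI S (p' + 1) (z n) ≤ (|K| + 1) * fI S (p' + 1) (z n) :=
      mul_le_mul_of_nonneg_right (by linarith [le_abs_self K]) h3.le
    linarith
  · obtain ⟨c, hc, hlow⟩ := fI_lower hnice (p' + 1) le_rfl
    rw [Metric.tendsto_atTop']
    intro e he
    have hκ : 0 < e * c / (2 * ((p' + 1 : ℕ) : ℝ)) := by positivity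
    obtain ⟨N, hN⟩ := eventually_atTop.1 ((hev _ hκ).and hzpos)
    refine ⟨N, fun n hn => ?_⟩
    obtain ⟨⟨-, hn⟩, hzn⟩ := hN n hn.le
    have hzn' : 0 < S (z n) := hzn
    have hxn : 0 < S (x n) := lt_of_lt_of_le hzn' (hS (hxz n).le)
    obtain ⟨d1, d2⟩ := diff_bound hnice (hxz n) hκ.le hn (p' + 1) le_rfl (x n) le_rfl (hxz n).le
    have h3 := hfpos (x n) hxn
    have h4 := hlow (x n) (z n) (hxz n).le
    rw [eR, eJ, mul_div_mul_left _ _ (inv_pos.2 hxn).ne', Real.dist_eq]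
    have e1 : jI S (z n) (p' + 1) (x n) / fI S (p' + 1) (x n) - 1 =
        -((fI S (p' + 1) (x n) - jI S (z n) (p' + 1) (x n)) / fI S (p' + 1) (x n)) := by
      field_simp; ring
    rw [e1, abs_neg, abs_of_nonneg (by positivity), div_lt_iff₀ h3]
    have e2 : ((p' + 1 : ℕ) : ℝ) * (e * c / (2 * ((p' + 1 : ℕ) : ℝ)) *
        (z n - x n) ^ (p' + 1) * S (z n)) =
        e / 2 * (c * ((z n - x n) ^ (p' + 1) * S (z n))) := by
      field_simp
    rw [e2] at d2
    nlinarith [mul_le_mul_of_nonneg_left h4 (half_pos he).le, mul_pos he h3]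

end
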